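/- Let m be a positive odd integer and set φ_k = cos((2k+1)π/m). Then ∫₀¹ log(x^m + 1)/(x² + 1) dx = (mπ/8)·log 2 − ((m−1)/2)·G + (π/4)·Σ_{k=0}^{(m-3)/2} log(1 + sin((2k+1)π/m)) + Σ_{k=0}^{(m-3)/2} Ti₂( (√(1 − φ_k²) − 1)/φ_k ), where the sums are empty (equal to 0) when m = 1. -/

import Mathlib

open Real MeasureTheory intervalIntegral Finset

/-- Inverse tangent integral Ti₂(x) = ∫₀ˣ arctan u / u du. -/
noncomputable def Ti2 (x : ℝ) : ℝ := ∫ u in (0:ℝ)..x, Real.arctan u / u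

/-- Catalan's constant G = Σ_{k≥0} (-1)^k/(2k+1)². -/
noncomputable def catalanG : ℝ := ∑' k : ℕ, (-1 : ℝ) ^ k / (2 * (k : ℝ) + 1) ^ 2

lemma aux_quad {x s : ℝ} (hx : 0 ≤ x) (δ : ℝ) (h0 : 0 ≤ δ) (h1 : δ ≤ 1) (hs : δ ≤ 1 - s) :
    δ ≤ x ^ 2 - 2 * x * s + 1 := by
  nlinarith [mul_nonneg hx (sub_nonneg.2 hs), mul_nonneg h0 (sub_nonneg.2 h1),
    sq_nonneg (x - (1 - δ))]

lemma aux_quad_pos {x s : ℝ} (hx : 0 ≤ x) (hs : s < 1) : 0 < x ^ 2 - 2 * x * s + 1 := by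
  have : 0 < min 1 (1 - s) := lt_min one_pos (by linarith)
  have h := aux_quad hx (min 1 (1 - s)) this.le (min_le_left _ _) (min_le_right _ _)
  linarith

noncomputable def KK (s : ℝ) : ℝ := ∫ x in (0:ℝ)..1, Real.log (x ^ 2 - 2 * x * s + 1) / (x ^ 2 + 1)

lemma cont_log (s : ℝ) (hs : s < 1) :
    ContinuousOn (fun x : ℝ => Real.log (x ^ 2 - 2 * x * s + 1) / (x ^ 2 + 1)) (Set.Icc 0 1) := by
  apply ContinuousOn.div
  · apply ContinuousOn.log (by fun_prop)
    intro x hx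
    exact (aux_quad_pos hx.1 hs).ne'
  · fun_prop
  · intro x _; positivity

lemma cont_der (s : ℝ) (hs : s < 1) :
    ContinuousOn (fun x : ℝ => -(2 * x) / (x ^ 2 - 2 * x * s + 1) / (x ^ 2 + 1)) (Set.Icc 0 1) := by
  apply ContinuousOn.div
  · apply ContinuousOn.div (by fun_prop) (by fun_prop)
    intro x hx
    exact (aux_quad_pos hx.1 hs).ne'
  · fun_prop
  · intro x _; positivity

lemma KK_deriv (s : ℝ) (hs : s < 1) :
    HasDerivAt KK (∫ x in (0:ℝ)..1, -(2 * x) / (x ^ 2 - 2 * x * s + 1) / (x ^ 2 + 1)) s := by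
  have hu : Set.uIoc (0:ℝ) 1 = Set.Ioc 0 1 := Set.uIoc_of_le zero_le_one
  have hsub : Set.Ioc (0:ℝ) 1 ⊆ Set.Icc 0 1 := Set.Ioc_subset_Icc_self
  set r := (s + 1) / 2 with hr
  have hr1 : r < 1 := by rw [hr]; linarith
  have hsr : s < r := by rw [hr]; linarith
  set δ := min 1 (1 - r) with hδ
  have hδ0 : 0 < δ := lt_min one_pos (by linarith)
  refine (intervalIntegral.hasDerivAt_integral_of_dominated_loc_of_deriv_le
    (F := fun s x => Real.log (x ^ 2 - 2 * x * s + 1) / (x ^ 2 + 1))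
    (F' := fun s x => -(2 * x) / (x ^ 2 - 2 * x * s + 1) / (x ^ 2 + 1))
    (bound := fun _ => 2 / δ) (s := Set.Iio r) (Iio_mem_nhds hsr) ?_ ?_ ?_ ?_ ?_ ?_).2
  · filter_upwards [Iio_mem_nhds hsr] with y hy
    rw [hu]
    exact ((cont_log y (lt_trans hy hr1)).mono hsub).aestronglyMeasurable measurableSet_Ioc
  · apply ContinuousOn.intervalIntegrable
    rw [Set.uIcc_of_le zero_le_one]
    exact cont_log s hs
  · rw [hu]
    exact ((cont_der s hs).mono hsub).aestronglyMeasurable measurableSet_Ioc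
  · refine Filter.Eventually.of_forall fun x hx y hy => ?_
    rw [hu] at hx
    have h1 : δ ≤ x ^ 2 - 2 * x * y + 1 := by
      apply aux_quad hx.1.le δ hδ0.le (min_le_left _ _)
      have := min_le_right 1 (1 - r)
      have : y < r := hy
      linarith
    have h2 : (1:ℝ) ≤ x ^ 2 + 1 := by nlinarith [sq_nonneg x]
    rw [norm_div, norm_div, norm_neg, Real.norm_of_nonneg (by linarith [hx.1] : 0 ≤ 2 * x),
      Real.norm_of_nonneg (by linarith : 0 ≤ x ^ 2 - 2 * x * y + 1),
      Real.norm_of_nonneg (by linarith : 0 ≤ x ^ 2 + 1)]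
    have h0 : 0 ≤ 2 * x / (x ^ 2 - 2 * x * y + 1) := div_nonneg (by linarith [hx.1]) (by linarith)
    refine (div_le_self h0 h2).trans ?_
    exact div_le_div₀ (by norm_num) (by linarith [hx.2]) hδ0 h1
  · exact intervalIntegrable_const
  · refine Filter.Eventually.of_forall fun x hx y hy => ?_
    rw [hu] at hx
    have h1 := aux_quad_pos hx.1.le (lt_trans (show y < r from hy) hr1)
    have h3 : HasDerivAt (fun y => x ^ 2 - 2 * x * y + 1) (-(2 * x)) y := by
      have := (((hasDerivAt_id y).const_mul (2 * x)).const_sub (x ^ 2)).add_const 1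
      simpa using this
    exact (h3.log h1.ne').div_const _

noncomputable def DS (x : ℝ) : ℝ := dslope Real.arctan 0 x

lemma DS_cont : Continuous DS := by
  rw [← continuousOn_univ]
  exact (continuousOn_dslope Filter.univ_mem).2
    ⟨Real.continuous_arctan.continuousOn, Real.differentiable_arctan 0⟩

lemma DS_ne {x : ℝ} (hx : x ≠ 0) : DS x = Real.arctan x / x := by
  rw [DS, dslope_of_ne _ hx, slope_def_field]; simp

lemma DS_zero : DS 0 = 1 := by
  rw [DS, dslope_same]; simp

lemma Ti2_eq (x : ℝ) : Ti2 x = ∫ u in (0:ℝ)..x, DS u := by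
  unfold Ti2
  apply intervalIntegral.integral_congr_ae
  have : ∀ᵐ u : ℝ, u ≠ 0 := by simp [ae_iff]
  filter_upwards [this] with u hu _
  rw [DS_ne hu]

lemma Ti2_deriv (x : ℝ) : HasDerivAt Ti2 (DS x) x := by
  have : Ti2 = fun x => ∫ u in (0:ℝ)..x, DS u := funext Ti2_eq
  rw [this]
  exact intervalIntegral.integral_hasDerivAt_right (DS_cont.intervalIntegrable _ _)
    DS_cont.stronglyMeasurable.stronglyMeasurableAtFilter DS_cont.continuousAt

lemma Ti2_one : Ti2 1 = catalanG := by
  have hint : ∀ n : ℕ, ∫ x in Set.Ioc (0:ℝ) 1, x ^ (2 * n) / (2 * (n:ℝ) + 1)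
      = 1 / (2 * (n:ℝ) + 1) ^ 2 := by
    intro n
    rw [← intervalIntegral.integral_of_le zero_le_one, intervalIntegral.integral_div, integral_pow]
    simp
    field_simp
  have key := MeasureTheory.hasSum_integral_of_summable_integral_norm
    (μ := volume.restrict (Set.Ioc (0:ℝ) 1))
    (F := fun (n:ℕ) (x:ℝ) => (-1:ℝ) ^ n * (x ^ (2 * n) / (2 * (n:ℝ) + 1))) ?_ ?_
  · have h1 : ∀ n : ℕ, ∫ x in Set.Ioc (0:ℝ) 1, (-1:ℝ) ^ n * (x ^ (2 * n) / (2 * (n:ℝ) + 1))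
        = (-1 : ℝ) ^ n / (2 * (n : ℝ) + 1) ^ 2 := by
      intro n
      rw [MeasureTheory.integral_const_mul, hint]; ring
    simp only [h1] at key
    rw [catalanG, key.tsum_eq, Ti2, intervalIntegral.integral_of_le zero_le_one]
    apply MeasureTheory.integral_congr_ae
    have hne : ∀ᵐ u : ℝ ∂(volume.restrict (Set.Ioc (0:ℝ) 1)), u ≠ 1 :=
      ae_restrict_of_ae (by simp [ae_iff])
    filter_upwards [hne, ae_restrict_mem measurableSet_Ioc] with u hu1 hu
    have hlt : u < 1 := lt_of_le_of_ne hu.2 hu1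
    have := (Real.hasSum_arctan (x := u) (by rw [Real.norm_of_nonneg hu.1.le]; exact hlt)).div_const u
    rw [← this.tsum_eq]
    apply tsum_congr
    intro n
    have := hu.1.ne'
    push_cast
    field_simp
    ring
  · intro n
    apply Continuous.integrableOn_Ioc
    fun_prop
  · have h2 : ∀ n : ℕ, ∫ x in Set.Ioc (0:ℝ) 1, ‖(-1:ℝ) ^ n * (x ^ (2 * n) / (2 * (n:ℝ) + 1))‖
        = 1 / (2 * (n : ℝ) + 1) ^ 2 := by
      intro n
      rw [← hint]
      congr 1
      ext x
      rw [norm_mul, norm_pow, norm_neg, norm_one, one_pow, one_mul, Real.norm_of_nonneg]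
      rw [pow_mul]; positivity
    simp only [h2]
    have h3 := (Real.summable_one_div_nat_pow (p := 2)).2 (by norm_num)
    have h4 := h3.comp_injective (i := fun n : ℕ => 2 * n + 1) (fun a b h => by simpa using h)
    refine h4.congr fun n => ?_
    simp

lemma base_log : ∫ x in (0:ℝ)..1, Real.log (x + 1) / (x ^ 2 + 1) = π / 8 * Real.log 2 := by
  have hc : ContinuousOn (fun x : ℝ => Real.log (x + 1) / (x ^ 2 + 1)) (Set.Icc 0 1) := by
    apply ContinuousOn.div
    · apply ContinuousOn.log (by fun_prop)
      intro x hx; linarith [hx.1]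
    · fun_prop
    · intro x _; positivity
  have hu : Set.uIcc (0:ℝ) 1 = Set.Icc 0 1 := Set.uIcc_of_le zero_le_one
  have hd : ∀ x ∈ Set.Icc (0:ℝ) 1, HasDerivAt (fun x : ℝ => (1 - x) / (1 + x)) (-2 / (1 + x) ^ 2) x := by
    intro x hx
    have : 1 + x ≠ 0 := by linarith [hx.1]
    have := ((hasDerivAt_id x).const_sub 1).div ((hasDerivAt_id x).const_add 1) this
    refine this.congr_deriv ?_
    simp only [id]
    ring
  have key := intervalIntegral.integral_comp_mul_deriv'' (a := 0) (b := 1)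
    (f := fun x : ℝ => (1 - x) / (1 + x)) (f' := fun x => -2 / (1 + x) ^ 2)
    (g := fun x : ℝ => Real.log (x + 1) / (x ^ 2 + 1)) ?_ ?_ ?_ ?_
  · have h1 : ∫ x in (0:ℝ)..1, ((fun x : ℝ => Real.log (x + 1) / (x ^ 2 + 1)) ∘ (fun x : ℝ => (1 - x) / (1 + x))) x
        * (-2 / (1 + x) ^ 2) = ∫ x in (0:ℝ)..1, (Real.log (x + 1) / (x ^ 2 + 1) - Real.log 2 * (1 / (1 + x ^ 2))) := by
      apply intervalIntegral.integral_congr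
      intro x hx
      rw [hu] at hx
      have hx1 : 1 + x ≠ 0 := by linarith [hx.1]
      have e : (1 - x) / (1 + x) + 1 = 2 / (x + 1) := by rw [add_comm x 1]; field_simp; ring
      have e2 : ((1 - x) / (1 + x)) ^ 2 + 1 = 2 * (1 + x ^ 2) / (1 + x) ^ 2 := by field_simp; ring
      simp only [Function.comp]
      rw [e, e2, Real.log_div (by norm_num) (by linarith [hx.1])]
      have : 1 + x ^ 2 ≠ 0 := by positivity
      rw [add_comm (x ^ 2) 1]
      field_simp
      ring
    rw [h1, intervalIntegral.integral_sub, intervalIntegral.integral_const_mul,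
      integral_one_div_one_add_sq] at key
    · have e1 : (1 - (0:ℝ)) / (1 + 0) = 1 := by norm_num
      have e2 : (1 - (1:ℝ)) / (1 + 1) = 0 := by norm_num
      simp only [e1, e2, Real.arctan_one, Real.arctan_zero] at key
      rw [intervalIntegral.integral_symm 0 1] at key
      linarith
    · exact ContinuousOn.intervalIntegrable (by rw [hu]; exact hc)
    · apply Continuous.intervalIntegrable
      apply Continuous.mul continuous_const
      apply Continuous.div continuous_const (by fun_prop)
      intro x; positivity
  · rw [hu]; exact fun x hx => (hd x hx).continuousAt.continuousWithinAt
  · intro x hx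
    simp only [zero_le_one, min_eq_left, max_eq_right] at hx
    exact (hd x (Set.Ioo_subset_Icc_self hx)).hasDerivWithinAt
  · rw [hu]
    apply ContinuousOn.div (by fun_prop) (by fun_prop)
    intro x hx
    have : 0 < 1 + x := by linarith [hx.1]
    positivity
  · rw [hu]
    refine hc.mono ?_
    rintro _ ⟨x, hx, rfl⟩
    have : 0 < 1 + x := by linarith [hx.1]
    refine ⟨div_nonneg (by linarith [hx.2]) this.le, ?_⟩
    simp only
    rw [div_le_one this]; linarith [hx.1]

lemma half_tan {t : ℝ} (h1 : -(π / 2) < t) (h2 : t < π / 2) :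
    (Real.cos t - 1) / Real.sin t = -Real.tan (t / 2) := by
  have hc : 0 < Real.cos (t / 2) := Real.cos_pos_of_mem_Ioo ⟨by linarith, by linarith⟩
  have e : t = 2 * (t / 2) := by ring
  have hs : Real.sin t = 2 * Real.sin (t / 2) * Real.cos (t / 2) := by
    conv_lhs => rw [e, Real.sin_two_mul]
  have hcc : Real.cos t = 1 - 2 * Real.sin (t / 2) ^ 2 := by
    conv_lhs => rw [e, Real.cos_two_mul, Real.cos_sq']
    ring
  rw [hs, hcc, Real.tan_eq_sin_div_cos]
  by_cases h0 : Real.sin (t / 2) = 0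
  · simp [h0]
  · field_simp
    ring

lemma KK'_eval {t : ℝ} (h1 : -(π / 2) < t) (h2 : t < π / 2) (h0 : t ≠ 0) :
    ∫ x in (0:ℝ)..1, -(2 * x) / (x ^ 2 - 2 * x * Real.sin t + 1) / (x ^ 2 + 1)
      = -(1 / Real.sin t) * ((π / 4 + t / 2) / Real.cos t - π / 4) := by
  have hc : 0 < Real.cos t := Real.cos_pos_of_mem_Ioo ⟨h1, h2⟩
  have hs : Real.sin t ≠ 0 := by
    intro h
    exact h0 ((Real.sin_eq_zero_iff_of_lt_of_lt (by linarith [Real.pi_pos]) (by linarith [Real.pi_pos])).1 h)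
  have hsc := Real.sin_sq_add_cos_sq t
  have hs1 : Real.sin t < 1 := by nlinarith
  have hu : Set.uIcc (0:ℝ) 1 = Set.Icc 0 1 := Set.uIcc_of_le zero_le_one
  rw [intervalIntegral.integral_eq_sub_of_hasDerivAt
    (f := fun x => -(1 / Real.sin t) * (Real.arctan ((x - Real.sin t) / Real.cos t) / Real.cos t - Real.arctan x))]
  · have e1 : (1 - Real.sin t) / Real.cos t = Real.tan (π / 4 - t / 2) := by
      have hca : 0 < Real.cos (π / 4 - t / 2) := Real.cos_pos_of_mem_Ioo ⟨by linarith, by linarith⟩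
      have q1 : Real.cos t = 2 * Real.sin (π / 4 - t / 2) * Real.cos (π / 4 - t / 2) := by
        rw [← Real.sin_two_mul, ← Real.sin_pi_div_two_sub]; congr 1; ring
      have q2 : Real.sin t = 1 - 2 * Real.sin (π / 4 - t / 2) ^ 2 := by
        have := Real.cos_two_mul (π / 4 - t / 2)
        rw [Real.cos_sq'] at this
        rw [← Real.cos_pi_div_two_sub]
        have e : π / 2 - t = 2 * (π / 4 - t / 2) := by ring
        rw [e, this]; ring
      have hsa : Real.sin (π / 4 - t / 2) ≠ 0 := by
        intro h; rw [h] at q1; simp at q1; linarith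
      rw [q1, q2, Real.tan_eq_sin_div_cos]
      generalize Real.sin (π / 4 - t / 2) = S at *
      generalize Real.cos (π / 4 - t / 2) = C at *
      field_simp
      ring
    have e2 : (0 - Real.sin t) / Real.cos t = Real.tan (-t) := by
      rw [Real.tan_neg, Real.tan_eq_sin_div_cos]; ring
    rw [e1, e2, Real.arctan_tan (by linarith) (by linarith), Real.arctan_tan (by linarith) (by linarith),
      Real.arctan_one, Real.arctan_zero]
    ring
  · intro x hx
    rw [hu] at hx
    have hq := aux_quad_pos hx.1 hs1
    have d1 : HasDerivAt (fun x => (x - Real.sin t) / Real.cos t) (1 / Real.cos t) x :=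
      ((hasDerivAt_id x).sub_const _).div_const _
    have := (((d1.arctan).div_const (Real.cos t)).sub (Real.hasDerivAt_arctan x)).const_mul (-(1 / Real.sin t))
    refine this.congr_deriv ?_
    symm
    have e : 1 + ((x - Real.sin t) / Real.cos t) ^ 2 = (x ^ 2 - 2 * x * Real.sin t + 1) / Real.cos t ^ 2 := by
      field_simp
      linarith
    rw [e]
    have : 1 + x ^ 2 ≠ 0 := by positivity
    rw [add_comm (x ^ 2) 1]
    have hq' := hq.ne'
    clear e hq this
    generalize hQ : x ^ 2 - 2 * x * Real.sin t + 1 = Q at *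
    field_simp
    first | linear_combination hQ | linear_combination -hQ
  · exact ContinuousOn.intervalIntegrable (by rw [hu]; exact cont_der _ hs1)

lemma KK'_zero :
    ∫ x in (0:ℝ)..1, -(2 * x) / (x ^ 2 - 2 * x * 0 + 1) / (x ^ 2 + 1) = -1 / 2 := by
  rw [intervalIntegral.integral_eq_sub_of_hasDerivAt (f := fun x => 1 / (x ^ 2 + 1))]
  · norm_num
  · intro x _
    have h : x ^ 2 + 1 ≠ 0 := by positivity
    have := ((hasDerivAt_pow 2 x).add_const 1).fun_inv h
    simp only [one_div]
    refine this.congr_deriv ?_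
    simp only [mul_zero, sub_zero]
    field_simp
    norm_num
    ring
  · exact ContinuousOn.intervalIntegrable (by rw [Set.uIcc_of_le zero_le_one]; exact cont_der _ one_pos)

noncomputable def RR (t : ℝ) : ℝ :=
  π / 4 * Real.log 2 - catalanG + π / 4 * Real.log (1 + Real.cos t) + Ti2 (-Real.tan (t / 2))

lemma RR_deriv {t : ℝ} (h1 : -π < t) (h2 : t < π) :
    HasDerivAt RR (π / 4 * (-Real.sin t / (1 + Real.cos t))
      + DS (-Real.tan (t / 2)) * (-(1 / Real.cos (t / 2) ^ 2 * (1 / 2)))) t := by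
  have hc : 0 < Real.cos (t / 2) := Real.cos_pos_of_mem_Ioo ⟨by linarith, by linarith⟩
  have hcc : 1 + Real.cos t = 2 * Real.cos (t / 2) ^ 2 := by
    have e : t = 2 * (t / 2) := by ring
    conv_lhs => rw [e, Real.cos_two_mul]
    ring
  have d1 : HasDerivAt (fun t => Real.log (1 + Real.cos t)) (-Real.sin t / (1 + Real.cos t)) t :=
    ((Real.hasDerivAt_cos t).const_add 1).log (by rw [hcc]; positivity)
  have d2 : HasDerivAt (fun t => -Real.tan (t / 2)) (-(1 / Real.cos (t / 2) ^ 2 * (1 / 2))) t :=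
    (HasDerivAt.comp (h₂ := Real.tan) t (Real.hasDerivAt_tan hc.ne') ((hasDerivAt_id t).div_const 2)).neg
  have d3 := (Ti2_deriv (-Real.tan (t / 2))).comp t d2
  exact ((d1.const_mul (π / 4)).const_add (π / 4 * Real.log 2 - catalanG)).add d3

lemma KK_neg_one : KK (-1) = π / 4 * Real.log 2 := by
  have : KK (-1) = ∫ x in (0:ℝ)..1, 2 * (Real.log (x + 1) / (x ^ 2 + 1)) := by
    unfold KK
    apply intervalIntegral.integral_congr
    intro x _
    simp only
    rw [show x ^ 2 - 2 * x * (-1) + 1 = (x + 1) ^ 2 by ring, Real.log_pow]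
    push_cast; ring
  rw [this, intervalIntegral.integral_const_mul, base_log]; ring

lemma KK_eq {t : ℝ} (h1 : -(π / 2) < t) (h2 : t < π / 2) : KK (Real.sin t) = RR t := by
  have hpi := Real.pi_pos
  have hlt : ∀ y ∈ Set.Icc (-(π / 2)) t, Real.sin y < 1 := by
    intro y hy
    rw [← Real.sin_pi_div_two]
    exact Real.sin_lt_sin_of_lt_of_le_pi_div_two hy.1 le_rfl (by linarith [hy.2])
  have hK : ∀ y ∈ Set.Icc (-(π / 2)) t, HasDerivAt (fun t => KK (Real.sin t)) _ y := fun y hy =>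
    (KK_deriv _ (hlt y hy)).comp y (Real.hasDerivAt_sin y)
  have hR : ∀ y ∈ Set.Icc (-(π / 2)) t, HasDerivAt RR _ y := fun y hy =>
    RR_deriv (by linarith [hy.1]) (by linarith [hy.2])
  obtain ⟨c, hc, hcs⟩ := exists_hasDerivAt_eq_slope (fun t => KK (Real.sin t) - RR t) (fun _ => 0) h1
    (fun y hy => ((hK y hy).sub (hR y hy)).continuousAt.continuousWithinAt) (by
      intro y hy
      have hy' := Set.Ioo_subset_Icc_self hy
      refine ((hK y hy').sub (hR y hy')).congr_deriv ?_
      have hy1 : -(π / 2) < y := hy.1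
      have hy2 : y < π / 2 := by linarith [hy.2]
      rw [sub_eq_zero]
      by_cases h0 : y = 0
      · subst h0
        simp only [Real.sin_zero, KK'_zero]
        simp [DS_zero]
        norm_num
      · rw [KK'_eval hy1 hy2 h0]
        have hc : 0 < Real.cos (y / 2) := Real.cos_pos_of_mem_Ioo ⟨by linarith, by linarith⟩
        have hcy : 0 < Real.cos y := Real.cos_pos_of_mem_Ioo ⟨hy1, hy2⟩
        have hsn : Real.sin (y / 2) ≠ 0 := by
          intro h
          have := (Real.sin_eq_zero_iff_of_lt_of_lt (by linarith) (by linarith)).1 h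
          exact h0 (by linarith)
        have htn : -Real.tan (y / 2) ≠ 0 := by
          rw [Real.tan_eq_sin_div_cos]
          exact neg_ne_zero.2 (div_ne_zero hsn hc.ne')
        rw [DS_ne htn, Real.arctan_neg, Real.arctan_tan (by linarith) (by linarith),
          Real.tan_eq_sin_div_cos]
        have e : y = 2 * (y / 2) := by ring
        have hs2 : Real.sin y = 2 * Real.sin (y / 2) * Real.cos (y / 2) := by
          conv_lhs => rw [e, Real.sin_two_mul]
        have hc2 : Real.cos y = 2 * Real.cos (y / 2) ^ 2 - 1 := by
          conv_lhs => rw [e, Real.cos_two_mul]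
        have hcy' := hcy.ne'
        have hc' := hc.ne'
        have step : -(1 / Real.sin y) * ((π / 4 + y / 2) / Real.cos y - π / 4) * Real.cos y
          = -(1 / Real.sin y) * ((π / 4 + y / 2) - π / 4 * Real.cos y) := by
          field_simp
        rw [step, hs2, hc2]
        have hsq : Real.sin (y / 2) ^ 2 = 1 - Real.cos (y / 2) ^ 2 := Real.sin_sq _
        rw [show 1 + (2 * Real.cos (y / 2) ^ 2 - 1) = 2 * Real.cos (y / 2) ^ 2 by ring]
        field_simp
        rw [hsq]
        ring)
  have hne : t - -(π / 2) ≠ 0 := by linarith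
  have h3 := (eq_div_iff hne).1 hcs
  have h4 : KK (Real.sin (-(π / 2))) - RR (-(π / 2)) = 0 := by
    rw [Real.sin_neg, Real.sin_pi_div_two, KK_neg_one, RR, Real.cos_neg, Real.cos_pi_div_two,
      show -(π / 2) / 2 = -(π / 4) by ring, Real.tan_neg, Real.tan_pi_div_four, neg_neg, Ti2_one]
    simp
  simp only [h4] at h3
  linarith

lemma factor (n : ℕ) (x : ℝ) :
    x ^ (2 * n + 1) + 1 = (x + 1) * ∏ k ∈ Finset.range n,
      (x ^ 2 - 2 * x * Real.cos ((2 * (k : ℝ) + 1) * π / ((2 * n + 1 : ℕ) : ℝ)) + 1) := by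
  set m := 2 * n + 1 with hm
  have hm0 : (m : ℂ) ≠ 0 := Nat.cast_ne_zero.2 (by omega)
  have hmr : (m : ℝ) ≠ 0 := by rw [hm]; positivity
  have hz := Complex.isPrimitiveRoot_exp m (by omega)
  set ζ := Complex.exp (2 * ↑Real.pi * Complex.I / ↑m) with hζ
  have h := X_pow_sub_C_eq_prod hz (α := -1) (a := -1) (by omega) (Odd.neg_one_pow ⟨n, hm⟩)
  have h' := congrArg (Polynomial.eval (x : ℂ)) h
  simp only [Polynomial.eval_prod, Polynomial.eval_sub, Polynomial.eval_pow, Polynomial.eval_X,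
    Polynomial.eval_C] at h'
  have h2 : (x:ℂ) ^ m + 1 = ∏ i ∈ Finset.range m, ((x:ℂ) + ζ ^ i) := by
    rw [← sub_neg_eq_add, h']
    apply Finset.prod_congr rfl; intro i _; ring
  have h3 : ∏ i ∈ Finset.range m, ((x:ℂ) + ζ ^ i) = (x + 1) * ∏ k ∈ Finset.range n,
      (((x:ℂ) + ζ ^ (n - k)) * (x + ζ ^ (n + k + 1))) := by
    rw [hm, Finset.prod_range_succ', pow_zero, mul_comm, two_mul, Finset.prod_range_add,
      Finset.prod_mul_distrib]
    congr 2
    rw [← Finset.prod_range_reflect]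
    apply Finset.prod_congr rfl
    intro i hi
    rw [Finset.mem_range] at hi
    rw [show n - 1 - i + 1 = n - i by omega]
  have h4 : ∀ k ∈ Finset.range n, (((x:ℂ) + ζ ^ (n - k)) * (x + ζ ^ (n + k + 1)))
      = ((x ^ 2 - 2 * x * Real.cos ((2 * (k : ℝ) + 1) * π / (m : ℝ)) + 1 : ℝ) : ℂ) := by
    intro k hk
    rw [Finset.mem_range] at hk
    have hp : ζ ^ (n - k) * ζ ^ (n + k + 1) = 1 := by
      rw [← pow_add, show n - k + (n + k + 1) = m by omega, hz.pow_eq_one]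
    have e1 : ζ ^ (n - k) = -Complex.exp (-(((2 * (k : ℂ) + 1) * π / m)) * Complex.I) := by
      rw [hζ, ← Complex.exp_nat_mul, ← Complex.exp_add_pi_mul_I, Nat.cast_sub hk.le]
      congr 1
      field_simp
      rw [hm]; push_cast; ring
    have e2 : ζ ^ (n + k + 1) = -Complex.exp (((2 * (k : ℂ) + 1) * π / m) * Complex.I) := by
      rw [hζ, ← Complex.exp_nat_mul, ← Complex.exp_add_pi_mul_I]
      congr 1
      field_simp
      rw [hm]; push_cast; ring
    have e3 : ζ ^ (n - k) + ζ ^ (n + k + 1) = -(2 * Complex.cos ((2 * (k : ℂ) + 1) * π / m)) := by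
      rw [e1, e2, Complex.two_cos]; ring
    push_cast
    linear_combination hp + x * e3
  rw [Finset.prod_congr rfl h4] at h3
  rw [h3] at h2
  exact_mod_cast h2

theorem stmt_5 (m : ℕ) (hm : Odd m) (hm0 : 0 < m) :
    ∫ x in (0:ℝ)..1, Real.log (x ^ m + 1) / (x ^ 2 + 1) =
      (m : ℝ) * π / 8 * Real.log 2 - ((m : ℝ) - 1) / 2 * catalanG
        + (π / 4) * (∑ k ∈ Finset.range ((m - 1) / 2),
            Real.log (1 + Real.sin ((2 * (k : ℝ) + 1) * π / m)))
        + ∑ k ∈ Finset.range ((m - 1) / 2),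
            Ti2 ((Real.sqrt (1 - Real.cos ((2 * (k : ℝ) + 1) * π / m) ^ 2) - 1)
              / Real.cos ((2 * (k : ℝ) + 1) * π / m)) := by
  obtain ⟨n, hn⟩ := hm
  have hn2 : (m - 1) / 2 = n := by omega
  rw [hn2]
  have hpi := Real.pi_pos
  have hmpos : (0:ℝ) < m := by exact_mod_cast hm0
  have hθ : ∀ k ∈ Finset.range n, 0 < (2 * (k : ℝ) + 1) * π / m ∧ (2 * (k : ℝ) + 1) * π / m < π := by
    intro k hk
    rw [Finset.mem_range] at hk
    refine ⟨by positivity, ?_⟩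
    rw [div_lt_iff₀ hmpos, mul_comm]
    have : (2 * (k:ℝ) + 1) < m := by
      have : 2 * k + 1 < m := by omega
      exact_mod_cast this
    exact mul_lt_mul_of_pos_left this hpi
  have hcos : ∀ k ∈ Finset.range n, Real.cos ((2 * (k : ℝ) + 1) * π / m) < 1 := by
    intro k hk
    refine lt_of_lt_of_eq ?_ Real.cos_zero
    exact Real.cos_lt_cos_of_nonneg_of_le_pi le_rfl (hθ k hk).2.le (hθ k hk).1
  have hu : Set.uIcc (0:ℝ) 1 = Set.Icc 0 1 := Set.uIcc_of_le zero_le_one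
  have hint : ∫ x in (0:ℝ)..1, Real.log (x ^ m + 1) / (x ^ 2 + 1)
      = ∫ x in (0:ℝ)..1, (Real.log (x + 1) / (x ^ 2 + 1) + ∑ k ∈ Finset.range n,
        Real.log (x ^ 2 - 2 * x * Real.cos ((2 * (k : ℝ) + 1) * π / m) + 1) / (x ^ 2 + 1)) := by
    apply intervalIntegral.integral_congr
    intro x hx
    rw [hu] at hx
    simp only
    have hf := factor n x
    rw [← hn] at hf
    rw [hf, Real.log_mul, Real.log_prod, add_div, Finset.sum_div]
    · intro k hk; exact (aux_quad_pos hx.1 (hcos k hk)).ne'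
    · linarith [hx.1]
    · exact Finset.prod_ne_zero_iff.2 fun k hk => (aux_quad_pos hx.1 (hcos k hk)).ne'
  have hii : ∀ k ∈ Finset.range n, IntervalIntegrable (fun x : ℝ =>
      Real.log (x ^ 2 - 2 * x * Real.cos ((2 * (k : ℝ) + 1) * π / m) + 1) / (x ^ 2 + 1)) volume 0 1 :=
    fun k hk => ContinuousOn.intervalIntegrable (by rw [hu]; exact cont_log _ (hcos k hk))
  rw [hint, intervalIntegral.integral_add, intervalIntegral.integral_finsetSum hii, base_log]
  · have hk : ∀ k ∈ Finset.range n, (∫ x in (0:ℝ)..1,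
        Real.log (x ^ 2 - 2 * x * Real.cos ((2 * (k : ℝ) + 1) * π / m) + 1) / (x ^ 2 + 1))
        = (π / 4 * Real.log 2 - catalanG) + π / 4 * Real.log (1 + Real.sin ((2 * (k : ℝ) + 1) * π / m))
          + Ti2 ((Real.sqrt (1 - Real.cos ((2 * (k : ℝ) + 1) * π / m) ^ 2) - 1)
              / Real.cos ((2 * (k : ℝ) + 1) * π / m)) := by
      intro k hk
      obtain ⟨a1, a2⟩ := hθ k hk
      generalize (2 * (k : ℝ) + 1) * π / m = θ at a1 a2
      have := KK_eq (t := π / 2 - θ) (by linarith) (by linarith)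
      rw [RR, ← half_tan (t := π / 2 - θ) (by linarith) (by linarith), Real.sin_pi_div_two_sub,
        Real.cos_pi_div_two_sub, KK] at this
      rw [this, ← Real.sin_sq, Real.sqrt_sq (Real.sin_pos_of_pos_of_lt_pi a1 a2).le]
    rw [Finset.sum_congr rfl hk, Finset.sum_add_distrib, Finset.sum_add_distrib, Finset.sum_const,
      Finset.card_range, nsmul_eq_mul, ← Finset.mul_sum, hn]
    push_cast
    ring
  · apply ContinuousOn.intervalIntegrable
    rw [hu]
    apply ContinuousOn.div
    · apply ContinuousOn.log (by fun_prop)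
      intro x hx; linarith [hx.1]
    · fun_prop
    · intro x _; positivity
  · have := IntervalIntegrable.sum _ hii
    refine this.congr ?_
    intro x _
    simp
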